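/- On a 2-dimensional projective structure with metaplectic structure, the spinor tractor D-operator D_A : S(w) → S(w−1) ⊗ E_A defined by D_A = (4w+3)(w+1/4)Y_A + (4w+3)X^b{}_A ∇_b + γ_b X^b{}_A D_s, where E_A is the dual standard projective tractor bundle with splitting injectors Y_A, X_A{}^a and D_s = γ^a∇_a, is a projectively invariant first order differential operator. For w = −1/4 it reduces to the projectively invariant symplectic twistor operator ∇_a + (1/2)γ_a D_s : S(−1/4) → E_a ⊠ S(−1/4). -/

import Mathlib

/-!
# Statement 8

On a 2-dimensional projective structure with metaplectic structure, the spinor tractor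
`D`-operator `D_A : S(w) → S(w−1) ⊗ E_A` defined by
`D_A = (4w+3)(w+1/4) Y_A + (4w+3) X^b{}_A ∇_b + γ_b X^b{}_A D_s`
is a projectively invariant first order differential operator.  For `w = −1/4` it reduces to
the projectively invariant symplectic twistor operator
`∇_a + (1/2) γ_a D_s : S(−1/4) → E_a ⊠ S(−1/4)`.

Here `E_A` is the dual standard projective tractor bundle, with splitting injectors
`Y_A ∈ E_A(−1)`, `X_A{}^a ∈ E_A{}^a(−1)` in a projective scale, transforming under the change
of scale parametrised by `Υ_a` as `Ŷ_A = Y_A − X_A{}^a Υ_a`, `X̂_A{}^a = X_A{}^a`; the spinor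
connection transforms as `∇̂_aφ = ∇_aφ + (w+1/4)Υ_aφ − (1/4)γ_aΥ_sγ^sφ`, and
`D_s = γ^a ∇_a`.
-/

/-- Abstract model of the weighted symplectic spinor calculus together with the dual standard
tractor bundle on a 2-dimensional projective structure with metaplectic structure.
`TSp w` models sections of `S(w−1) ⊗ E_A`. -/
structure TractorSpinorCalc where
  /-- one-forms `Υ_a` parametrising changes of projective scale -/
  Omega1 : Type
  /-- sections of `S(w)` -/
  Sp : ℝ → Type
  /-- sections of `T*M ⊗ S(w)` -/
  OSp : ℝ → Type
  /-- sections of `S(w−1) ⊗ E_A` -/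
  TSp : ℝ → Type
  [acgO : AddCommGroup Omega1]
  [modO : Module ℝ Omega1]
  [acgS : ∀ w, AddCommGroup (Sp w)]
  [modS : ∀ w, Module ℝ (Sp w)]
  [acgOS : ∀ w, AddCommGroup (OSp w)]
  [modOS : ∀ w, Module ℝ (OSp w)]
  [acgT : ∀ w, AddCommGroup (TSp w)]
  [modT : ∀ w, Module ℝ (TSp w)]
  /-- `∇_a` on `S(w)` in the chosen scale -/
  nabla : ∀ w, Sp w →ₗ[ℝ] OSp w
  /-- `∇̂_a` on `S(w)` in the scale changed by `Υ` -/
  nablaHat : Omega1 → ∀ w, Sp w →ₗ[ℝ] OSp w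
  /-- `(Υ, φ) ↦ Υ_a ⊗ φ` -/
  tens : ∀ w, Omega1 →ₗ[ℝ] Sp w →ₗ[ℝ] OSp w
  /-- `(Υ, φ) ↦ Υ_s γ^s φ` -/
  gammaPair : ∀ w, Omega1 →ₗ[ℝ] Sp w →ₗ[ℝ] Sp (w - 3 / 2)
  /-- `ψ ↦ γ_a ψ` -/
  gammaLow : ∀ w, Sp (w - 3 / 2) →ₗ[ℝ] OSp w
  /-- `φ_a ↦ γ^a φ_a` (so `D_s = gammaContr ∘ ∇`) -/
  gammaContr : ∀ w, OSp w →ₗ[ℝ] Sp (w - 3 / 2)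
  /-- the injector `Y_A : φ ↦ Y_A φ ∈ S(w−1) ⊗ E_A`, in the chosen scale -/
  Ymap : ∀ w, Sp w →ₗ[ℝ] TSp w
  /-- the (scale independent) injector `X_A{}^a : φ_a ↦ X^a{}_A φ_a` -/
  Xmap : ∀ w, OSp w →ₗ[ℝ] TSp w
  /-- transformation rule of the spinor connection -/
  transf : ∀ (Υ : Omega1) (w : ℝ) (φ : Sp w),
    nablaHat Υ w φ
      = nabla w φ + (w + 1 / 4) • tens w Υ φ - (1 / 4 : ℝ) • gammaLow w (gammaPair w Υ φ)
  /-- `γ^a (Υ_a φ) = Υ_s γ^s φ` -/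
  contr_tens : ∀ (w : ℝ) (Υ : Omega1) (φ : Sp w), gammaContr w (tens w Υ φ) = gammaPair w Υ φ
  /-- `γ^a γ_a = −2` (real dimension 2) -/
  contr_low : ∀ (w : ℝ) (ψ : Sp (w - 3 / 2)), gammaContr w (gammaLow w ψ) = (-2 : ℝ) • ψ

attribute [instance] TractorSpinorCalc.acgO TractorSpinorCalc.modO TractorSpinorCalc.acgS
  TractorSpinorCalc.modS TractorSpinorCalc.acgOS TractorSpinorCalc.modOS
  TractorSpinorCalc.acgT TractorSpinorCalc.modT

namespace TractorSpinorCalc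

variable (Δ : TractorSpinorCalc)

/-- The symplectic Dirac operator `D_s = γ^a ∇̂_a` in the scale changed by `Υ`. -/
noncomputable def Ds (Υ : Δ.Omega1) (w : ℝ) : Δ.Sp w →ₗ[ℝ] Δ.Sp (w - 3 / 2) :=
  (Δ.gammaContr w).comp (Δ.nablaHat Υ w)

/-- The tractor `D`-operator
`D_A = (4w+3)(w+1/4) Y_A + (4w+3) X^b{}_A ∇_b + γ_b X^b{}_A D_s : S(w) → S(w−1) ⊗ E_A`,
computed in the scale changed by `Υ` (so with `Ŷ_A = Y_A − X_A{}^a Υ_a`, `∇̂` and `D̂_s`). -/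
noncomputable def DA (Υ : Δ.Omega1) (w : ℝ) : Δ.Sp w →ₗ[ℝ] Δ.TSp w :=
  ((4 * w + 3) * (w + 1 / 4)) • (Δ.Ymap w - (Δ.Xmap w).comp (Δ.tens w Υ))
    + (4 * w + 3) • ((Δ.Xmap w).comp (Δ.nablaHat Υ w))
    + (Δ.Xmap w).comp ((Δ.gammaLow w).comp (Δ.Ds Υ w))

/-- The symplectic twistor operator `∇_a + (1/2) γ_a D_s` on `S(w)`, in the scale changed
by `Υ`. -/
noncomputable def twistor (Υ : Δ.Omega1) (w : ℝ) : Δ.Sp w →ₗ[ℝ] Δ.OSp w :=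
  Δ.nablaHat Υ w + (1 / 2 : ℝ) • (Δ.gammaLow w).comp (Δ.Ds Υ w)

end TractorSpinorCalc

namespace TractorSpinorCalc

/-- Transformation rule of the symplectic Dirac operator under a change of scale. -/
theorem Ds_apply (Δ : TractorSpinorCalc) (Υ : Δ.Omega1) (w : ℝ) (φ : Δ.Sp w) :
    Δ.Ds Υ w φ = Δ.gammaContr w (Δ.nabla w φ) + (w + 3 / 4) • Δ.gammaPair w Υ φ := by
  simp only [Ds, LinearMap.comp_apply, Δ.transf, map_add, map_sub, map_smul, Δ.contr_tens,
    Δ.contr_low]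
  module

/-- The tractor `D`-operator of any scale, expressed through the reference scale. -/
theorem DA_apply (Δ : TractorSpinorCalc) (Υ : Δ.Omega1) (w : ℝ) (φ : Δ.Sp w) :
    Δ.DA Υ w φ = ((4 * w + 3) * (w + 1 / 4)) • Δ.Ymap w φ
      + (4 * w + 3) • Δ.Xmap w (Δ.nabla w φ)
      + Δ.Xmap w (Δ.gammaLow w (Δ.gammaContr w (Δ.nabla w φ))) := by
  simp only [DA, LinearMap.add_apply, LinearMap.sub_apply, LinearMap.smul_apply,
    LinearMap.comp_apply, Ds_apply, Δ.transf, map_add, map_sub, map_smul]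
  module

/-- On `S(-1/4)`, the symplectic twistor operator of any scale is that of the reference scale. -/
theorem twistor_apply (Δ : TractorSpinorCalc) (Υ : Δ.Omega1) (φ : Δ.Sp (-1 / 4)) :
    Δ.twistor Υ (-1 / 4) φ = Δ.nabla (-1 / 4) φ
      + (1 / 2 : ℝ) • Δ.gammaLow (-1 / 4) (Δ.gammaContr (-1 / 4) (Δ.nabla (-1 / 4) φ)) := by
  simp only [twistor, LinearMap.add_apply, LinearMap.smul_apply, LinearMap.comp_apply,
    Ds_apply, Δ.transf, map_add, map_smul]
  module

end TractorSpinorCalc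

/-- The spinor tractor `D`-operator
`D_A = (4w+3)(w+1/4) Y_A + (4w+3) X^b{}_A ∇_b + γ_b X^b{}_A D_s : S(w) → S(w−1) ⊗ E_A`
is projectively invariant (independent of the choice of projective scale) for every weight
`w`; for `w = −1/4` it reduces to (twice) the symplectic twistor operator
`∇_a + (1/2) γ_a D_s : S(−1/4) → E_a ⊠ S(−1/4)`, which is itself projectively invariant. -/
theorem tractorD_invariant (Δ : TractorSpinorCalc) (w : ℝ) :
    (∀ Υ Υ' : Δ.Omega1, Δ.DA Υ w = Δ.DA Υ' w)
    ∧ (∀ Υ : Δ.Omega1,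
        Δ.DA Υ (-1 / 4) = (2 : ℝ) • (Δ.Xmap (-1 / 4)).comp (Δ.twistor Υ (-1 / 4)))
    ∧ (∀ Υ Υ' : Δ.Omega1, Δ.twistor Υ (-1 / 4) = Δ.twistor Υ' (-1 / 4)) := by
  refine ⟨fun Υ Υ' => ?_, fun Υ => ?_, fun Υ Υ' => ?_⟩ <;> ext φ
  · simp only [Δ.DA_apply]
  · simp only [Δ.DA_apply, Δ.twistor_apply, LinearMap.smul_apply, LinearMap.comp_apply, map_add,
      map_smul]
    module
  · simp only [Δ.twistor_apply]
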